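/- For every u ≥ 0, every a ∈ ℝ, and every R ∈ ℂ with Re R > 0, one has e^{−u a² R} = 1 − u^{1/2}|a| ∫₀^∞ (J₁(2|a|√(uv))/√v)·exp{−R^{−1}v} dv. -/

import Mathlib

open MeasureTheory

/-- The Bessel function of the first kind of order one. -/
noncomputable def besselJ1 (x : ℝ) : ℝ :=
  (x / 2) * ∑' k : ℕ, (-(x ^ 2 / 4)) ^ k / ((Nat.factorial k : ℝ) * (Nat.factorial (k + 1)))
lemma integral_pow_mul_exp_neg_mul_Ioi (k : ℕ) {ρ : ℝ} (hρ : 0 < ρ) :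
    ∫ v in Set.Ioi (0 : ℝ), v ^ k * Real.exp (-ρ * v) =
      (ρ⁻¹) ^ (k + 1) * (k.factorial : ℝ) := by
  have h := Real.integral_rpow_mul_exp_neg_mul_Ioi (a := (k : ℝ) + 1) (r := ρ)
    (by positivity) hρ
  rw [Real.Gamma_nat_eq_factorial, one_div] at h
  simp only [add_sub_cancel_right] at h
  simp only [Real.rpow_natCast, ← Nat.cast_succ] at h
  simpa only [neg_mul] using h

lemma norm_pow_mul_cexp_neg_mul (k : ℕ) (r : ℂ) {v : ℝ} (hv : 0 < v) :
    ‖(v : ℂ) ^ k * Complex.exp (-r * v)‖ = v ^ k * Real.exp (-r.re * v) := by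
  simp [Complex.norm_exp, abs_of_pos hv]

lemma integrableOn_pow_mul_cexp_neg_mul_Ioi (k : ℕ) {r : ℂ} (hr : 0 < r.re) :
    IntegrableOn (fun v : ℝ ↦ (v : ℂ) ^ k * Complex.exp (-r * v)) (Set.Ioi 0) := by
  have hreal : IntegrableOn (fun v : ℝ ↦ v ^ k * Real.exp (-r.re * v)) (Set.Ioi 0) := by
    refine not_imp_comm.1 integral_undef ?_
    rw [integral_pow_mul_exp_neg_mul_Ioi k hr]
    positivity
  refine Integrable.mono' hreal (by fun_prop) ?_
  filter_upwards [ae_restrict_mem measurableSet_Ioi] with v hv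
  exact (norm_pow_mul_cexp_neg_mul k r hv).le

lemma integral_pow_mul_cexp_neg_mul_Ioi (k : ℕ) {r : ℂ} (hr : 0 < r.re) :
    ∫ v in Set.Ioi (0 : ℝ), (v : ℂ) ^ k * Complex.exp (-r * v) =
      (r⁻¹) ^ (k + 1) * (k.factorial : ℂ) := by
  have hr0 : r ≠ 0 := by
    rintro rfl
    simp at hr
  induction k with
  | zero =>
    have h := integral_exp_mul_complex_Ioi (a := -r) (by simpa using hr) 0
    simpa using h
  | succ k ih =>
    have hderiv (v : ℝ) : HasDerivAt (fun v : ℝ ↦ (v : ℂ) ^ (k + 1) * Complex.exp (-r * v))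
        (((k : ℂ) + 1) * ((v : ℂ) ^ k * Complex.exp (-r * v)) -
          r * ((v : ℂ) ^ (k + 1) * Complex.exp (-r * v))) v := by
      have h1 := hasDerivAt_pow (k + 1) (v : ℂ)
      have h2 := ((hasDerivAt_id (v : ℂ)).const_mul (-r)).cexp
      convert! (h1.mul h2).comp_ofReal using 1
      simp only [add_tsub_cancel_right, Nat.cast_add, Nat.cast_one, id_eq]
      ring
    have hk := (integrableOn_pow_mul_cexp_neg_mul_Ioi k hr).const_mul ((k : ℂ) + 1)
    have hk' := (integrableOn_pow_mul_cexp_neg_mul_Ioi (k + 1) hr).const_mul r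
    have hlim : Filter.Tendsto (fun v : ℝ ↦ (v : ℂ) ^ (k + 1) * Complex.exp (-r * v))
        Filter.atTop (nhds 0) := by
      rw [tendsto_zero_iff_norm_tendsto_zero]
      refine (tendsto_rpow_mul_exp_neg_mul_atTop_nhds_zero ((k + 1 : ℕ) : ℝ) r.re hr).congr' ?_
      filter_upwards [Filter.eventually_gt_atTop 0] with v hv
      rw [norm_pow_mul_cexp_neg_mul _ r hv, Real.rpow_natCast]
    have h := integral_Ioi_of_hasDerivAt_of_tendsto' (a := 0) (fun v _ ↦ hderiv v)
      (hk.sub hk') hlim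
    rw [integral_sub hk hk', integral_const_mul, integral_const_mul, ih] at h
    have h' : r * ∫ v in Set.Ioi (0 : ℝ), (v : ℂ) ^ (k + 1) * Complex.exp (-r * v) =
        ((k : ℂ) + 1) * ((r⁻¹) ^ (k + 1) * (k.factorial : ℂ)) := by
      simp at h
      simpa using (sub_eq_zero.1 h).symm
    rw [← mul_right_inj' hr0, h', Nat.factorial_succ, pow_succ _ (k + 1)]
    push_cast
    field_simp

/-- Laplace transform of the power series `∑ (-c v)ᵏ / (k! (k+1)!)`. -/
lemma hasSum_integral_bessel_series (c : ℝ) {r : ℂ} (hr : 0 < r.re) :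
    HasSum (fun k : ℕ ↦ (-(c : ℂ)) ^ k * (r⁻¹) ^ (k + 1) / ((k + 1).factorial : ℂ))
      (∫ v in Set.Ioi (0 : ℝ),
        (↑(∑' k : ℕ, (-(c * v)) ^ k / ((k.factorial : ℝ) * (k + 1).factorial)) : ℂ) *
          Complex.exp (-r * v)) := by
  set b : ℕ → ℂ := fun k ↦ (-(c : ℂ)) ^ k / ((k.factorial : ℂ) * (k + 1).factorial) with hb
  set F : ℕ → ℝ → ℂ := fun k v ↦ b k * ((v : ℂ) ^ k * Complex.exp (-r * v)) with hF
  have hInt (k : ℕ) : Integrable (F k) (volume.restrict (Set.Ioi 0)) :=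
    (integrableOn_pow_mul_cexp_neg_mul_Ioi k hr).const_mul _
  have hnorm (k : ℕ) : ∫ v in Set.Ioi (0 : ℝ), ‖F k v‖ =
      (|c| * r.re⁻¹) ^ k / (k + 1).factorial * r.re⁻¹ := by
    have : ∫ v in Set.Ioi (0 : ℝ), ‖F k v‖ =
        ∫ v in Set.Ioi (0 : ℝ), ‖b k‖ * (v ^ k * Real.exp (-r.re * v)) := by
      refine setIntegral_congr_fun measurableSet_Ioi fun v hv ↦ ?_
      simp only [hF]
      rw [norm_mul, norm_pow_mul_cexp_neg_mul k r hv]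
    rw [this, integral_const_mul, integral_pow_mul_exp_neg_mul_Ioi k hr]
    have hk : (k.factorial : ℝ) ≠ 0 := by positivity
    have hk' : ((k + 1).factorial : ℝ) ≠ 0 := by positivity
    simp only [hb, norm_div, norm_mul, norm_pow, norm_neg, Complex.norm_real, Real.norm_eq_abs,
      Complex.norm_natCast, mul_pow, pow_succ]
    field_simp
  have hsum : Summable fun k ↦ ∫ v in Set.Ioi (0 : ℝ), ‖F k v‖ := by
    simp_rw [hnorm]
    refine Summable.mul_right _ ?_
    refine Summable.of_nonneg_of_le (fun k ↦ by positivity) (fun k ↦ ?_)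
      (Real.summable_pow_div_factorial (|c| * r.re⁻¹))
    gcongr
    simp
  convert! hasSum_integral_of_summable_integral_norm hInt hsum using 1
  · ext k
    simp only [hF]
    rw [integral_const_mul, integral_pow_mul_cexp_neg_mul_Ioi k hr]
    have hk : (k.factorial : ℂ) ≠ 0 := by exact_mod_cast k.factorial_ne_zero
    simp only [hb]
    field_simp
  · congr 1
    ext v
    simp only [hF, hb]
    rw [Complex.ofReal_tsum, ← tsum_mul_right]
    refine tsum_congr fun k ↦ ?_
    push_cast
    rw [neg_mul_eq_neg_mul, mul_pow]
    ring

lemma hasSum_one_sub_exp_neg (z : ℂ) :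
    HasSum (fun k : ℕ ↦ -((-z) ^ (k + 1) / ((k + 1).factorial : ℂ)))
      (1 - Complex.exp (-z)) := by
  have h := NormedSpace.expSeries_div_hasSum_exp (-z)
  rw [← Complex.exp_eq_exp_ℂ] at h
  simpa using ((hasSum_nat_add_iff' 1).2 h).neg

lemma besselJ1_div_sqrt {u : ℝ} (hu : 0 ≤ u) (a : ℝ) {v : ℝ} (hv : 0 < v) :
    besselJ1 (2 * |a| * Real.sqrt (u * v)) / Real.sqrt v =
      Real.sqrt u * |a| *
        ∑' k : ℕ, (-(u * a ^ 2 * v)) ^ k / ((k.factorial : ℝ) * (k + 1).factorial) := by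
  have hsq : (2 * |a| * Real.sqrt (u * v)) ^ 2 / 4 = u * a ^ 2 * v := by
    rw [mul_pow, mul_pow, sq_abs, Real.sq_sqrt (by positivity)]
    ring
  have hv' : Real.sqrt v ≠ 0 := (Real.sqrt_pos.2 hv).ne'
  rw [besselJ1, hsq, Real.sqrt_mul hu]
  field_simp

/-- For every `u ≥ 0`, `a ∈ ℝ` and `R ∈ ℂ` with `Re R > 0`,
`e^{−u a² R} = 1 − u^{1/2}|a| ∫₀^∞ (J₁(2|a|√(uv))/√v)·e^{−R⁻¹ v} dv`. -/
theorem exp_eq_one_sub_integral_besselJ1 (u : ℝ) (hu : 0 ≤ u) (a : ℝ) (R : ℂ)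
    (hR : 0 < R.re) :
    Complex.exp (-(↑(u * a ^ 2) * R)) =
      1 - (↑(Real.sqrt u) * ↑|a| : ℂ) *
        ∫ v in Set.Ioi (0 : ℝ),
          (↑(besselJ1 (2 * |a| * Real.sqrt (u * v)) / Real.sqrt v) : ℂ) *
            Complex.exp (-R⁻¹ * ↑v) := by
  have hR0 : R ≠ 0 := by
    rintro rfl
    simp at hR
  have hr : 0 < (R⁻¹).re := by
    rw [Complex.inv_re]
    exact div_pos hR (Complex.normSq_pos.2 hR0)
  have hcoef : (↑(Real.sqrt u) * ↑|a| : ℂ) * (↑(Real.sqrt u) * ↑|a|) = ↑(u * a ^ 2) := by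
    norm_cast
    rw [mul_mul_mul_comm, Real.mul_self_sqrt hu, abs_mul_abs_self, sq]
  have hint : ∫ v in Set.Ioi (0 : ℝ),
      (↑(besselJ1 (2 * |a| * Real.sqrt (u * v)) / Real.sqrt v) : ℂ) *
        Complex.exp (-R⁻¹ * ↑v) = (↑(Real.sqrt u) * ↑|a| : ℂ) * ∫ v in Set.Ioi (0 : ℝ),
      (↑(∑' k : ℕ, (-(u * a ^ 2 * v)) ^ k / ((k.factorial : ℝ) * (k + 1).factorial)) : ℂ) *
        Complex.exp (-R⁻¹ * v) := by
    rw [← integral_const_mul]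
    refine setIntegral_congr_fun measurableSet_Ioi fun v hv ↦ ?_
    rw [besselJ1_div_sqrt hu a hv, Complex.ofReal_mul, Complex.ofReal_mul, mul_assoc]
  rw [hint, ← mul_assoc, hcoef]
  have hsum := (hasSum_integral_bessel_series (u * a ^ 2) hr).mul_left (↑(u * a ^ 2) : ℂ)
  rw [inv_inv] at hsum
  rw [hsum.unique (a₂ := 1 - Complex.exp (-(↑(u * a ^ 2) * R))), sub_sub_cancel]
  convert! hasSum_one_sub_exp_neg (↑(u * a ^ 2) * R) using 2 with k
  rw [neg_mul_eq_neg_mul, mul_pow]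
  ring
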